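/- For the n × n grid graph G_{n×n} with its standard plane embedding, the facial Thue chromatic number satisfies π_f(G_{n×n}) ≤ 4. -/

import Mathlib

/-- A list `l` is a repetition if it is some nonempty block repeated twice. -/
def IsRepetition {α : Type*} (l : List α) : Prop :=
  ∃ w : List α, w ≠ [] ∧ l = w ++ w

/-- A list is nonrepetitive if no nonempty block of consecutive terms forms a repetition. -/
def NonrepetitiveList {α : Type*} (l : List α) : Prop :=
  ∀ w : List α, w ≠ [] → ¬ (w ++ w) <:+: l

/-- The consecutive pairs of a list read cyclically; a list `w` represents the closed
walk whose steps are exactly `cyclicPairs w`. -/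
def cyclicPairs {V : Type*} (w : List V) : List (V × V) := w.zip (w.rotate 1)

/-- A plane graph: a finite simple graph together with a fixed embedding in the plane,
described combinatorially.  Every face is recorded by the collection of its boundary
closed walks (a face of a disconnected plane graph may be bounded by several closed
walks), one face is designated as the outer face, every edge occurs exactly twice on
face boundaries, and Euler's formula `V - E + F = 1 + C` (where `C` is the number of
connected components) holds, which characterizes embeddings in the plane. -/
structure PlaneGraph (V : Type) [Fintype V] [DecidableEq V] where
  graph : SimpleGraph V
  faces : Multiset (Multiset (List V))
  outer : Multiset (List V)
  outer_mem : outer ∈ faces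
  walk_ne : ∀ F ∈ faces, ∀ w ∈ F, w ≠ []
  walk_adj : ∀ F ∈ faces, ∀ w ∈ F, 2 ≤ w.length → ∀ p ∈ cyclicPairs w, graph.Adj p.1 p.2
  edge_twice : ∀ e ∈ graph.edgeSet,
    Multiset.count e
      (Multiset.sum (faces.map (fun F =>
        Multiset.sum (F.map (fun w =>
          (((cyclicPairs w).map (fun p => s(p.1, p.2)) : List (Sym2 V)) : Multiset (Sym2 V))))))) = 2
  euler : Fintype.card V + Multiset.card faces
      = (graph.edgeSet).ncard + 1 + Nat.card graph.ConnectedComponent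

variable {V : Type} [Fintype V] [DecidableEq V]

/-- The vertices incident with the outer face of a plane graph. -/
def PlaneGraph.boundaryVerts (P : PlaneGraph V) : Set V :=
  {v | ∃ w ∈ P.outer, v ∈ w}

/-- A facial path of a plane graph: a (vertex-)path consisting of consecutive vertices
on the boundary of a face. -/
def PlaneGraph.IsFacialPath (P : PlaneGraph V) (p : List V) : Prop :=
  p ≠ [] ∧ p.Nodup ∧ ∃ F ∈ P.faces, ∃ w ∈ F, p <:+: (w ++ w)

/-- A facial nonrepetitive vertex coloring: the sequence of colors along any facial
path is nonrepetitive. -/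
def PlaneGraph.FacialNonrepColoring {α : Type*} (P : PlaneGraph V) (c : V → α) : Prop :=
  ∀ p : List V, P.IsFacialPath p → NonrepetitiveList (p.map c)

/-- The facial Thue chromatic number: the minimum number of colors of a facial
nonrepetitive vertex coloring. -/
noncomputable def PlaneGraph.facialThue (P : PlaneGraph V) : ℕ :=
  sInf {n : ℕ | ∃ c : V → Fin n, P.FacialNonrepColoring c}

/-- The `n × n` grid graph: vertex set `{1,…,n} × {1,…,n}` (here `Fin n × Fin n`),
two vertices adjacent iff they differ by `1` in exactly one coordinate. -/
def gridGraph (n : ℕ) : SimpleGraph (Fin n × Fin n) :=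
  SimpleGraph.fromRel (fun p q =>
    (p.1 = q.1 ∧ (p.2 : ℕ) + 1 = (q.2 : ℕ)) ∨ (p.2 = q.2 ∧ (p.1 : ℕ) + 1 = (q.1 : ℕ)))

/-- The Thue–Morse sequence: the parity of the number of binary digits `1`. -/
def thueMorse (n : ℕ) : ℕ :=
  if n = 0 then 0 else (thueMorse (n / 2) + n) % 2

lemma thueMorse_lt_two (n : ℕ) : thueMorse n < 2 := by
  unfold thueMorse
  split_ifs <;> omega

lemma thueMorse_two_mul (n : ℕ) : thueMorse (2 * n) = thueMorse n := by
  rcases Nat.eq_zero_or_pos n with rfl | hn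
  · rfl
  · have h := thueMorse_lt_two n
    rw [thueMorse, if_neg (by omega), Nat.mul_div_cancel_left n two_pos]
    omega

lemma thueMorse_two_mul_add_one (n : ℕ) : thueMorse (2 * n + 1) = 1 - thueMorse n := by
  have h := thueMorse_lt_two n
  rw [thueMorse, if_neg (by omega), show (2 * n + 1) / 2 = n by omega]
  omega

/-- The Thue–Morse sequence has no three consecutive equal terms. -/
lemma thueMorse_no_cube (i : ℕ) :
    ¬ (thueMorse i = thueMorse (i + 1) ∧ thueMorse (i + 1) = thueMorse (i + 2)) := by
  rintro ⟨h₁, h₂⟩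
  obtain ⟨j, rfl | rfl⟩ := Nat.even_or_odd' i
  · have := thueMorse_lt_two j
    rw [thueMorse_two_mul, thueMorse_two_mul_add_one] at h₁
    omega
  · have := thueMorse_lt_two (j + 1)
    rw [show 2 * j + 1 + 1 = 2 * (j + 1) by ring,
      show 2 * j + 1 + 2 = 2 * (j + 1) + 1 by ring, thueMorse_two_mul,
      thueMorse_two_mul_add_one] at h₂
    omega

/-- A pair of equal consecutive terms of the Thue–Morse sequence starts at an odd position. -/
lemma odd_of_thueMorse_eq_succ {m : ℕ} (h : thueMorse m = thueMorse (m + 1)) : m % 2 = 1 := by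
  obtain ⟨j, rfl | rfl⟩ := Nat.even_or_odd' m
  · have := thueMorse_lt_two j
    rw [thueMorse_two_mul, thueMorse_two_mul_add_one] at h
    omega
  · omega

/-- Any five consecutive terms of the Thue–Morse sequence contain two equal neighbours. -/
lemma exists_thueMorse_eq_succ (i : ℕ) : ∃ m, i ≤ m ∧ m ≤ i + 3 ∧
    thueMorse m = thueMorse (m + 1) := by
  by_contra! h
  have key : ∀ a, i ≤ 2 * a + 1 → 2 * a + 1 ≤ i + 3 → thueMorse a = thueMorse (a + 1) := by
    intro a h₁ h₂
    have h₃ := h _ h₁ h₂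
    have h₄ := thueMorse_lt_two a
    have h₅ := thueMorse_lt_two (a + 1)
    rw [show 2 * a + 1 + 1 = 2 * (a + 1) by ring, thueMorse_two_mul,
      thueMorse_two_mul_add_one] at h₃
    omega
  exact thueMorse_no_cube (i / 2) ⟨key _ (by omega) (by omega), key _ (by omega) (by omega)⟩

/-- The Thue–Morse sequence is overlap-free. -/
theorem thueMorse_overlapFree (p : ℕ) (hp : 0 < p) (i : ℕ) :
    ∃ k ≤ p, thueMorse (i + k) ≠ thueMorse (i + k + p) := by
  induction p using Nat.strong_induction_on generalizing i with
  | _ p ih =>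
    by_contra! h
    obtain ⟨q, rfl | rfl⟩ := Nat.even_or_odd' p
    · obtain ⟨j, hj⟩ := Nat.even_or_odd' i
      obtain ⟨k, hk, hne⟩ := ih q (by omega) (by omega) j
      have h' := h (2 * k) (by omega)
      rcases hj with rfl | rfl
      · rw [show 2 * j + 2 * k = 2 * (j + k) by ring,
          show 2 * (j + k) + 2 * q = 2 * (j + k + q) by ring, thueMorse_two_mul,
          thueMorse_two_mul] at h'
        exact hne h'
      · have := thueMorse_lt_two (j + k)
        have := thueMorse_lt_two (j + k + q)
        rw [show 2 * j + 1 + 2 * k = 2 * (j + k) + 1 by ring,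
          show 2 * (j + k) + 1 + 2 * q = 2 * (j + k + q) + 1 by ring,
          thueMorse_two_mul_add_one, thueMorse_two_mul_add_one] at h'
        omega
    · have key : ∀ m, i ≤ m → m < i + (2 * q + 1) →
          (thueMorse m = thueMorse (m + 1) ↔
            thueMorse (m + (2 * q + 1)) = thueMorse (m + (2 * q + 1) + 1)) := by
        intro m h₁ h₂
        have h₃ := h (m - i) (by omega)
        have h₄ := h (m - i + 1) (by omega)
        rw [show i + (m - i) = m by omega] at h₃
        rw [show i + (m - i + 1) = m + 1 by omega,
          show m + 1 + (2 * q + 1) = m + (2 * q + 1) + 1 by ring] at h₄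
        rw [h₃, h₄]
      have key' : ∀ m, i ≤ m → m < i + (2 * q + 1) → thueMorse m ≠ thueMorse (m + 1) := by
        intro m h₁ h₂ h₃
        have h₄ := odd_of_thueMorse_eq_succ h₃
        have h₅ := odd_of_thueMorse_eq_succ ((key m h₁ h₂).1 h₃)
        omega
      rcases Nat.eq_zero_or_pos q with rfl | hq
      · exact key' i le_rfl (by omega) (h 0 (by omega))
      · obtain ⟨m, h₁, h₂, h₃⟩ := exists_thueMorse_eq_succ i
        rcases Nat.lt_or_ge m (i + (2 * q + 1)) with h₄ | h₄
        · exact key' m h₁ h₄ h₃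
        · have h₅ := (key (m - (2 * q + 1)) (by omega) (by omega)).2
          rw [show m - (2 * q + 1) + (2 * q + 1) = m by omega] at h₅
          exact key' _ (by omega) (by omega) (h₅ h₃)

/-- The ternary Thue word: the differences of the Thue–Morse sequence, shifted by `1`. -/
def thueWord (n : ℕ) : ℕ := thueMorse (n + 1) + 1 - thueMorse n

lemma thueWord_lt_three (n : ℕ) : thueWord n < 3 := by
  have := thueMorse_lt_two (n + 1)
  unfold thueWord
  omega

/-- The ternary Thue word is square-free. -/
theorem thueWord_squareFree (p : ℕ) (hp : 0 < p) (i : ℕ) :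
    ∃ k < p, thueWord (i + k) ≠ thueWord (i + k + p) := by
  by_contra! h
  have step : ∀ k ≤ p, thueMorse (i + k) + thueMorse (i + p) =
      thueMorse (i + k + p) + thueMorse i := by
    intro k
    induction k with
    | zero => intro _; simp [add_comm]
    | succ k ih =>
      intro hk
      have h₁ := ih (by omega)
      have h₂ := h k (by omega)
      have := thueMorse_lt_two (i + k)
      have := thueMorse_lt_two (i + k + p)
      rw [thueWord, thueWord, show i + k + p + 1 = i + (k + 1) + p by ring,
        show i + k + 1 = i + (k + 1) by ring] at h₂
      omega
  have hper : thueMorse i = thueMorse (i + p) := by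
    have := step p le_rfl
    have := thueMorse_lt_two i
    have := thueMorse_lt_two (i + p)
    have := thueMorse_lt_two (i + p + p)
    omega
  obtain ⟨k, hk, hne⟩ := thueMorse_overlapFree p hp i
  have := step k hk
  omega

/-- A coloring of `{0,…,N} × {0,…,N}` all of whose unit squares are colored properly
and not with the pattern `abab`. -/
structure IsSquareColoring (N : ℕ) (c : ℕ → ℕ → ℕ) : Prop where
  vert : ∀ i < N, ∀ j ≤ N, c i j ≠ c (i + 1) j
  horiz : ∀ i ≤ N, ∀ j < N, c i j ≠ c i (j + 1)
  diag : ∀ i < N, ∀ j < N, ¬ (c i j = c (i + 1) (j + 1) ∧ c (i + 1) j = c i (j + 1))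

/-- The position of a boundary vertex on the boundary cycle, starting at `(0, 0)`. -/
def boundaryIndex (N i j : ℕ) : ℕ :=
  if i = 0 then j else if j = N then N + i else if i = N then 3 * N - j else 4 * N - i

/-- The boundary cycle colored by a word `b`, except for the color `3` at `(0, 0)`. -/
def boundaryColor (N : ℕ) (b : ℕ → ℕ) (i j : ℕ) : ℕ :=
  if i = 0 ∧ j = 0 then 3 else b (boundaryIndex N i j)

lemma boundaryIndex_one_zero {N : ℕ} (hN : 1 ≤ N) : boundaryIndex N 1 0 = 4 * N - 1 := by
  unfold boundaryIndex
  split_ifs <;> first | contradiction | omega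

lemma boundaryIndex_succ_left {N i j : ℕ} (hj : j = 0 ∨ j = N) (hi : i < N)
    (h : ¬ (i = 0 ∧ j = 0)) : boundaryIndex N (i + 1) j = boundaryIndex N i j + 1 ∨
      boundaryIndex N i j = boundaryIndex N (i + 1) j + 1 := by
  unfold boundaryIndex
  split_ifs <;> first | contradiction | omega

lemma boundaryIndex_succ_right {N i j : ℕ} (hi : i = 0 ∨ i = N) (hj : j < N) :
    boundaryIndex N i (j + 1) = boundaryIndex N i j + 1 ∨
      boundaryIndex N i j = boundaryIndex N i (j + 1) + 1 := by
  unfold boundaryIndex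
  split_ifs <;> first | contradiction | omega

/-- A coloring of `{0,…,N} × {0,…,N}` whose boundary uses the color `3` at `(0, 0)` only,
whose vertices at distance `1` from the boundary alternate between `3` and other colors, and
whose remaining vertices avoid the color `3`. -/
structure IsFramedColoring (N : ℕ) (c : ℕ → ℕ → ℕ) : Prop where
  origin : c 0 0 = 3
  origin_ne : c 0 1 ≠ c 1 0
  boundary_lt : ∀ i ≤ N, ∀ j ≤ N, i = 0 ∨ i = N ∨ j = 0 ∨ j = N → ¬ (i = 0 ∧ j = 0) → c i j < 3
  boundary_vert : ∀ i < N, ∀ j, j = 0 ∨ j = N → c i j ≠ c (i + 1) j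
  boundary_horiz : ∀ i, i = 0 ∨ i = N → ∀ j < N, c i j ≠ c i (j + 1)
  core_lt : ∀ i j, 2 ≤ i → i + 2 ≤ N → 2 ≤ j → j + 2 ≤ N → c i j < 3
  core_vert : ∀ i j, 2 ≤ i → i + 3 ≤ N → 2 ≤ j → j + 2 ≤ N → c i j ≠ c (i + 1) j
  core_horiz : ∀ i j, 2 ≤ i → i + 2 ≤ N → 2 ≤ j → j + 3 ≤ N → c i j ≠ c i (j + 1)
  core_diag : ∀ i j, 2 ≤ i → i + 3 ≤ N → 2 ≤ j → j + 3 ≤ N → c i j ≠ c (i + 1) (j + 1)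
  ring_even : ∀ i j, 1 ≤ i → i + 1 ≤ N → 1 ≤ j → j + 1 ≤ N →
    i = 1 ∨ i + 1 = N ∨ j = 1 ∨ j + 1 = N → (i + j) % 2 = 0 → c i j = 3
  ring_odd : ∀ i j, 1 ≤ i → i + 1 ≤ N → 1 ≤ j → j + 1 ≤ N →
    i = 1 ∨ i + 1 = N ∨ j = 1 ∨ j + 1 = N → (i + j) % 2 = 1 → c i j < 3
  top : ∀ j, 1 ≤ j → j < N → c 0 j ≠ c 1 j
  bottom : ∀ i j, i + 1 = N → 1 ≤ j → j < N → c i j ≠ c (i + 1) j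
  left : ∀ i, 1 ≤ i → i < N → c i 0 ≠ c i 1
  right : ∀ i j, 1 ≤ i → i < N → j + 1 = N → c i j ≠ c i (j + 1)
  top_core : ∀ j, 2 ≤ j → j + 2 ≤ N → c 1 j ≠ c 2 j
  bottom_core : ∀ i j, i + 2 = N → 2 ≤ j → j + 2 ≤ N → c i j ≠ c (i + 1) j
  left_core : ∀ i, 2 ≤ i → i + 2 ≤ N → c i 1 ≠ c i 2
  right_core : ∀ i j, 2 ≤ i → i + 2 ≤ N → j + 2 = N → c i j ≠ c i (j + 1)
  corner_top : ∀ j, 1 ≤ j → j + 1 = N → N % 2 = 1 → ¬ (c 0 j = c 1 (j + 1) ∧ c 1 j = c 0 (j + 1))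
  corner_left : ∀ i, 1 ≤ i → i + 1 = N → N % 2 = 1 → ¬ (c i 0 = c (i + 1) 1 ∧ c (i + 1) 0 = c i 1)
  corner_top_core : ∀ j, 2 ≤ j → j + 2 = N → N % 2 = 1 → c 2 j ≠ c 1 (j + 1)
  corner_left_core : ∀ i, 2 ≤ i → i + 2 = N → N % 2 = 1 → c i 2 ≠ c (i + 1) 1

lemma IsFramedColoring.isSquareColoring {N : ℕ} {c : ℕ → ℕ → ℕ} (h : IsFramedColoring N c)
    (hN3 : N ≠ 3) : IsSquareColoring N c where
  vert i hi j hj := by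
    by_cases hj' : j = 0 ∨ j = N
    · exact h.boundary_vert i hi j hj'
    obtain rfl | hi0 := Nat.eq_zero_or_pos i
    · exact h.top j (by omega) (by omega)
    by_cases hiN : i + 1 = N
    · exact h.bottom i j hiN (by omega) (by omega)
    by_cases hring : j = 1 ∨ j + 1 = N
    · rcases Nat.mod_two_eq_zero_or_one (i + j) with hpar | hpar
      · have h₁ := h.ring_even i j (by omega) (by omega) (by omega) (by omega)
          (by omega) (by omega)
        have h₂ := h.ring_odd (i + 1) j (by omega) (by omega) (by omega) (by omega)
          (by omega) (by omega)
        omega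
      · have h₁ := h.ring_odd i j (by omega) (by omega) (by omega) (by omega)
          (by omega) (by omega)
        have h₂ := h.ring_even (i + 1) j (by omega) (by omega) (by omega) (by omega)
          (by omega) (by omega)
        omega
    by_cases hi1 : i = 1
    · subst hi1
      exact h.top_core j (by omega) (by omega)
    by_cases hi2 : i + 2 = N
    · exact h.bottom_core i j hi2 (by omega) (by omega)
    · exact h.core_vert i j (by omega) (by omega) (by omega) (by omega)
  horiz i hi j hj := by
    by_cases hi' : i = 0 ∨ i = N
    · exact h.boundary_horiz i hi' j hj
    obtain rfl | hj0 := Nat.eq_zero_or_pos j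
    · exact h.left i (by omega) (by omega)
    by_cases hjN : j + 1 = N
    · exact h.right i j (by omega) (by omega) hjN
    by_cases hring : i = 1 ∨ i + 1 = N
    · rcases Nat.mod_two_eq_zero_or_one (i + j) with hpar | hpar
      · have h₁ := h.ring_even i j (by omega) (by omega) (by omega) (by omega)
          (by omega) (by omega)
        have h₂ := h.ring_odd i (j + 1) (by omega) (by omega) (by omega) (by omega)
          (by omega) (by omega)
        omega
      · have h₁ := h.ring_odd i j (by omega) (by omega) (by omega) (by omega)
          (by omega) (by omega)
        have h₂ := h.ring_even i (j + 1) (by omega) (by omega) (by omega) (by omega)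
          (by omega) (by omega)
        omega
    by_cases hj1 : j = 1
    · subst hj1
      exact h.left_core i (by omega) (by omega)
    by_cases hj2 : j + 2 = N
    · exact h.right_core i j (by omega) (by omega) hj2
    · exact h.core_horiz i j (by omega) (by omega) (by omega) (by omega)
  diag i hi j hj := by
    rintro ⟨hd₁, hd₂⟩
    by_cases h00 : i = 0 ∧ j = 0
    · obtain ⟨rfl, rfl⟩ := h00
      exact h.origin_ne hd₂.symm
    by_cases hcore : 2 ≤ i ∧ i + 3 ≤ N ∧ 2 ≤ j ∧ j + 3 ≤ N
    · exact h.core_diag i j (by omega) (by omega) (by omega) (by omega) hd₁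
    by_cases ht : i = 0 ∧ j + 1 = N ∧ N % 2 = 1
    · obtain ⟨rfl, hj', hpar⟩ := ht
      exact h.corner_top j (by omega) hj' hpar ⟨hd₁, hd₂⟩
    by_cases hl : j = 0 ∧ i + 1 = N ∧ N % 2 = 1
    · obtain ⟨rfl, hi', hpar⟩ := hl
      exact h.corner_left i (by omega) hi' hpar ⟨hd₁, hd₂⟩
    by_cases ht' : i = 1 ∧ j + 2 = N ∧ N % 2 = 1
    · obtain ⟨rfl, hj', hpar⟩ := ht'
      exact h.corner_top_core j (by omega) hj' hpar hd₂
    by_cases hl' : j = 1 ∧ i + 2 = N ∧ N % 2 = 1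
    · obtain ⟨rfl, hi', hpar⟩ := hl'
      exact h.corner_left_core i (by omega) hi' hpar hd₂.symm
    have hlt : ∀ i' j', i' ≤ N → j' ≤ N → ¬ (i' = 0 ∧ j' = 0) →
        ¬ (1 ≤ i' ∧ i' + 1 ≤ N ∧ 1 ≤ j' ∧ j' + 1 ≤ N ∧
          (i' = 1 ∨ i' + 1 = N ∨ j' = 1 ∨ j' + 1 = N) ∧ (i' + j') % 2 = 0) → c i' j' < 3 := by
      intro i' j' h₁ h₂ h₃ h₄
      by_cases hb : i' = 0 ∨ i' = N ∨ j' = 0 ∨ j' = N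
      · exact h.boundary_lt i' h₁ j' h₂ hb h₃
      by_cases hr : i' = 1 ∨ i' + 1 = N ∨ j' = 1 ∨ j' + 1 = N
      · exact h.ring_odd i' j' (by omega) (by omega) (by omega) (by omega) hr (by omega)
      · exact h.core_lt i' j' (by omega) (by omega) (by omega) (by omega)
    by_cases hpar : (i + j) % 2 = 0
    · by_cases hring : 1 ≤ i ∧ i + 1 ≤ N ∧ 1 ≤ j ∧ j + 1 ≤ N ∧
          (i = 1 ∨ i + 1 = N ∨ j = 1 ∨ j + 1 = N)
      · have h₁ := h.ring_even i j (by omega) (by omega) (by omega) (by omega) (by omega) hpar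
        have h₂ := hlt (i + 1) (j + 1) (by omega) (by omega) (by omega) (by omega)
        omega
      · have h₁ := h.ring_even (i + 1) (j + 1) (by omega) (by omega) (by omega) (by omega)
          (by omega) (by omega)
        have h₂ := hlt i j (by omega) (by omega) h00 (by omega)
        omega
    · by_cases hring : 1 ≤ i ∧ j + 2 ≤ N ∧ (i = 1 ∨ i + 1 = N ∨ j = 0 ∨ j + 2 = N)
      · have h₁ := h.ring_even i (j + 1) (by omega) (by omega) (by omega) (by omega)
          (by omega) (by omega)
        have h₂ := hlt (i + 1) j (by omega) (by omega) (by omega) (by omega)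
        omega
      · have h₁ := h.ring_even (i + 1) j (by omega) (by omega) (by omega) (by omega)
          (by omega) (by omega)
        have h₂ := hlt i (j + 1) (by omega) (by omega) (by omega) (by omega)
        omega

lemma exists_third_color (x y z : ℕ) : ∃ r < 3, r ≠ x ∧ r ≠ z ∧ ¬ (x = z ∧ r = y) := by
  by_contra! h
  have h₀ := h 0
  have h₁ := h 1
  have h₂ := h 2
  omega

set_option maxHeartbeats 1000000 in
/-- A coloring of the boundary with the color `3` at `(0, 0)` only extends to a framed coloring
of the whole grid. -/
lemma exists_isFramedColoring {N : ℕ} (hN : 1 ≤ N) {B : ℕ → ℕ → ℕ} (hB0 : B 0 0 = 3)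
    (hB3 : ∀ i j, ¬ (i = 0 ∧ j = 0) → B i j < 3)
    (hBv : ∀ i j, j = 0 ∨ j = N → i < N → B i j ≠ B (i + 1) j)
    (hBh : ∀ i j, i = 0 ∨ i = N → j < N → B i j ≠ B i (j + 1)) (hBc : B 0 1 ≠ B 1 0) :
    ∃ c : ℕ → ℕ → ℕ, (∀ i j, c i j < 4) ∧ IsFramedColoring N c ∧
      ∀ i ≤ N, ∀ j ≤ N, i = 0 ∨ i = N ∨ j = 0 ∨ j = N → c i j = B i j := by
  obtain ⟨r₁, hr₁, hr₁x, hr₁z, hr₁d⟩ := exists_third_color (B 0 (N - 1)) (B 0 N) (B 1 N)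
  obtain ⟨r₂, hr₂, hr₂x, hr₂z, hr₂d⟩ := exists_third_color (B (N - 1) 0) (B N 0) (B N 1)
  obtain ⟨s, hs₁, hs₂⟩ : ∃ s, (N + s) % 3 ≠ r₁ ∧ (N + s) % 3 ≠ r₂ := by
    by_contra! h
    have h₀ := h 0
    have h₁ := h 1
    have h₂ := h 2
    omega
  have hB4 : ∀ i j, B i j < 4 := by
    intro i j
    have := hB3 i j
    by_cases h : i = 0 ∧ j = 0
    · rw [h.1, h.2, hB0]; omega
    · omega
  have hex : ∀ i j, ∃ x < 4,
      (i = 0 ∨ i ≥ N ∨ j = 0 ∨ j ≥ N → x = B i j) ∧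
      (2 ≤ i → i + 2 ≤ N → 2 ≤ j → j + 2 ≤ N → x = (i + j + s) % 3) ∧
      (1 ≤ i → i + 1 ≤ N → 1 ≤ j → j + 1 ≤ N → i = 1 ∨ i + 1 = N ∨ j = 1 ∨ j + 1 = N →
        (i + j) % 2 = 0 → x = 3) ∧
      (1 ≤ i → i + 1 ≤ N → 1 ≤ j → j + 1 ≤ N → i = 1 ∨ i + 1 = N ∨ j = 1 ∨ j + 1 = N →
        (i + j) % 2 = 1 → x < 3) ∧
      ((i + j) % 2 = 1 → i = 1 → 1 ≤ j → j < N → x ≠ B 0 j) ∧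
      ((i + j) % 2 = 1 → i + 1 = N → 1 ≤ j → j < N → x ≠ B N j) ∧
      ((i + j) % 2 = 1 → j = 1 → 1 ≤ i → i < N → x ≠ B i 0) ∧
      ((i + j) % 2 = 1 → j + 1 = N → 1 ≤ i → i < N → x ≠ B i N) ∧
      ((i + j) % 2 = 1 → i = 1 → 2 ≤ j → j + 2 ≤ N → x ≠ (2 + j + s) % 3) ∧
      ((i + j) % 2 = 1 → i + 1 = N → 2 ≤ j → j + 2 ≤ N → x ≠ (N - 2 + j + s) % 3) ∧
      ((i + j) % 2 = 1 → j = 1 → 2 ≤ i → i + 2 ≤ N → x ≠ (i + 2 + s) % 3) ∧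
      ((i + j) % 2 = 1 → j + 1 = N → 2 ≤ i → i + 2 ≤ N → x ≠ (i + (N - 2) + s) % 3) ∧
      ((i + j) % 2 = 1 → i = 1 → 1 ≤ j → j + 1 = N → x = r₁) ∧
      ((i + j) % 2 = 1 → i + 1 = N → 1 ≤ i → j = 1 → x = r₂) := by
    intro i j
    by_cases hbd : i = 0 ∨ i ≥ N ∨ j = 0 ∨ j ≥ N
    · exact ⟨B i j, hB4 i j, by omega⟩
    by_cases hcore : 2 ≤ i ∧ i + 2 ≤ N ∧ 2 ≤ j ∧ j + 2 ≤ N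
    · exact ⟨(i + j + s) % 3, by omega, by omega⟩
    by_cases hpar : (i + j) % 2 = 0
    · exact ⟨3, by omega, by omega⟩
    by_cases htr : i = 1 ∧ j = N - 1
    · obtain ⟨rfl, rfl⟩ := htr
      exact ⟨r₁, by omega, by omega⟩
    by_cases hbl : i = N - 1 ∧ j = 1
    · obtain ⟨rfl, rfl⟩ := hbl
      exact ⟨r₂, by omega, by omega⟩
    have hcases : (i = 1 ∧ 2 ≤ j ∧ j + 2 ≤ N) ∨ (i + 1 = N ∧ i ≠ 1 ∧ 2 ≤ j ∧ j + 2 ≤ N) ∨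
        (j = 1 ∧ 2 ≤ i ∧ i + 2 ≤ N) ∨ (j + 1 = N ∧ j ≠ 1 ∧ 2 ≤ i ∧ i + 2 ≤ N) := by omega
    rcases hcases with h | h | h | h
    · obtain ⟨r, h₁, h₂, h₃, -⟩ := exists_third_color (B 0 j) 0 ((2 + j + s) % 3)
      exact ⟨r, by omega, by omega⟩
    · obtain ⟨r, h₁, h₂, h₃, -⟩ := exists_third_color (B N j) 0 ((N - 2 + j + s) % 3)
      exact ⟨r, by omega, by omega⟩
    · obtain ⟨r, h₁, h₂, h₃, -⟩ := exists_third_color (B i 0) 0 ((i + 2 + s) % 3)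
      exact ⟨r, by omega, by omega⟩
    · obtain ⟨r, h₁, h₂, h₃, -⟩ := exists_third_color (B i N) 0 ((i + (N - 2) + s) % 3)
      exact ⟨r, by omega, by omega⟩
  choose c hc4 hbd hcore heven hodd htop hbottom hleft hright htopc hbottomc hleftc hrightc
    htr hbl using hex
  refine ⟨c, hc4, ?_, fun i hi j hj h ↦ hbd i j (by omega)⟩
  exact
    { origin := by rw [hbd 0 0 (by omega), hB0]
      origin_ne := by rwa [hbd 0 1 (by omega), hbd 1 0 (by omega)]
      boundary_lt := fun i hi j hj h h0 ↦ by
        rw [hbd i j (by omega)]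
        exact hB3 i j h0
      boundary_vert := fun i hi j hj ↦ by
        rw [hbd i j (by omega), hbd (i + 1) j (by omega)]
        exact hBv i j hj hi
      boundary_horiz := fun i hi j hj ↦ by
        rw [hbd i j (by omega), hbd i (j + 1) (by omega)]
        exact hBh i j hi hj
      core_lt := fun i j h₁ h₂ h₃ h₄ ↦ by
        rw [hcore i j h₁ h₂ h₃ h₄]
        omega
      core_vert := fun i j h₁ h₂ h₃ h₄ ↦ by
        rw [hcore i j h₁ (by omega) h₃ h₄, hcore (i + 1) j (by omega) (by omega) h₃ h₄]
        omega
      core_horiz := fun i j h₁ h₂ h₃ h₄ ↦ by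
        rw [hcore i j h₁ h₂ h₃ (by omega), hcore i (j + 1) h₁ h₂ (by omega) (by omega)]
        omega
      core_diag := fun i j h₁ h₂ h₃ h₄ ↦ by
        rw [hcore i j h₁ (by omega) h₃ (by omega),
          hcore (i + 1) (j + 1) (by omega) (by omega) (by omega) (by omega)]
        omega
      ring_even := heven
      ring_odd := hodd
      top := fun j h₁ h₂ ↦ by
        rw [hbd 0 j (by omega)]
        have h₃ := heven 1 j
        have h₄ := htop 1 j
        have h₅ := hB3 0 j
        omega
      bottom := fun i j hi h₁ h₂ ↦ by
        rw [hbd (i + 1) j (by omega)]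
        subst hi
        have h₃ := heven i j
        have h₄ := hbottom i j
        have h₅ := hB3 (i + 1) j
        omega
      left := fun i h₁ h₂ ↦ by
        rw [hbd i 0 (by omega)]
        have h₃ := heven i 1
        have h₄ := hleft i 1
        have h₅ := hB3 i 0
        omega
      right := fun i j h₁ h₂ hj ↦ by
        rw [hbd i (j + 1) (by omega)]
        subst hj
        have h₃ := heven i j
        have h₄ := hright i j
        have h₅ := hB3 i (j + 1)
        omega
      top_core := fun j h₁ h₂ ↦ by
        rw [hcore 2 j (by omega) (by omega) h₁ h₂]
        have h₃ := heven 1 j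
        have h₄ := htopc 1 j
        omega
      bottom_core := fun i j hi h₁ h₂ ↦ by
        rw [hcore i j (by omega) (by omega) h₁ h₂]
        have h₃ := heven (i + 1) j
        have h₄ := hbottomc (i + 1) j
        omega
      left_core := fun i h₁ h₂ ↦ by
        rw [hcore i 2 h₁ h₂ (by omega) (by omega)]
        have h₃ := heven i 1
        have h₄ := hleftc i 1
        omega
      right_core := fun i j h₁ h₂ hj ↦ by
        rw [hcore i j h₁ h₂ (by omega) (by omega)]
        have h₃ := heven i (j + 1)
        have h₄ := hrightc i (j + 1)
        omega
      corner_top := fun j h₁ hj hpar ↦ by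
        subst hj
        rw [hbd 0 j (by omega), hbd 1 (j + 1) (by omega), hbd 0 (j + 1) (by omega),
          htr 1 j (by omega) rfl h₁ rfl]
        exact hr₁d
      corner_left := fun i h₁ hi hpar ↦ by
        subst hi
        rw [hbd i 0 (by omega), hbd (i + 1) 1 (by omega), hbd (i + 1) 0 (by omega),
          hbl i 1 (by omega) rfl h₁ rfl]
        exact fun h ↦ hr₂d ⟨h.1, h.2.symm⟩
      corner_top_core := fun j h₁ hj hpar ↦ by
        rw [hcore 2 j (by omega) (by omega) h₁ (by omega),
          htr 1 (j + 1) (by omega) rfl (by omega) (by omega), add_comm 2 j, hj]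
        exact hs₁
      corner_left_core := fun i h₁ hi hpar ↦ by
        rw [hcore i 2 h₁ (by omega) (by omega) (by omega),
          hbl (i + 1) 1 (by omega) (by omega) (by omega) rfl, hi]
        exact hs₂ }

/-- A boundary coloring by a word over `{0, 1, 2}` extends to the whole grid, if `N ≠ 3`. -/
theorem exists_squareColoring {N : ℕ} (hN : 1 ≤ N) (hN3 : N ≠ 3) {b : ℕ → ℕ}
    (hb : ∀ k, b k < 3) (hbs : ∀ k, b k ≠ b (k + 1)) (hbe : b 1 ≠ b (4 * N - 1)) :
    ∃ c : ℕ → ℕ → ℕ, (∀ i j, c i j < 4) ∧ IsSquareColoring N c ∧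
      ∀ i ≤ N, ∀ j ≤ N, i = 0 ∨ i = N ∨ j = 0 ∨ j = N → c i j = boundaryColor N b i j := by
  have hB0 : boundaryColor N b 0 0 = 3 := by simp [boundaryColor]
  have hB3 : ∀ i j, ¬ (i = 0 ∧ j = 0) → boundaryColor N b i j < 3 := by
    intro i j h
    rw [boundaryColor, if_neg h]
    exact hb _
  have hBv : ∀ i j, j = 0 ∨ j = N → i < N →
      boundaryColor N b i j ≠ boundaryColor N b (i + 1) j := by
    intro i j hj hi
    by_cases h : i = 0 ∧ j = 0
    · have := hB3 (i + 1) j (by omega)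
      rw [h.1, h.2, zero_add] at *
      omega
    · rw [boundaryColor, boundaryColor, if_neg h, if_neg (by omega)]
      rcases boundaryIndex_succ_left hj hi h with h | h <;> rw [h]
      exacts [hbs _, (hbs _).symm]
  have hBh : ∀ i j, i = 0 ∨ i = N → j < N →
      boundaryColor N b i j ≠ boundaryColor N b i (j + 1) := by
    intro i j hi hj
    by_cases h : i = 0 ∧ j = 0
    · have := hB3 i (j + 1) (by omega)
      rw [h.1, h.2, zero_add] at *
      omega
    · rw [boundaryColor, boundaryColor, if_neg h, if_neg (by omega)]
      rcases boundaryIndex_succ_right hi hj with h | h <;> rw [h]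
      exacts [hbs _, (hbs _).symm]
  have hBc : boundaryColor N b 0 1 ≠ boundaryColor N b 1 0 := by
    have h₁ : boundaryIndex N 0 1 = 1 := by simp [boundaryIndex]
    simpa [boundaryColor, h₁, boundaryIndex_one_zero hN] using hbe
  obtain ⟨c, hc4, hc, hcb⟩ := exists_isFramedColoring hN hB0 hB3 hBv hBh hBc
  exact ⟨c, hc4, hc.isSquareColoring hN3, hcb⟩

/-- A coloring of `{0,…,N} × {0,…,N}` by `{0, 1, 2, 3}` which is facially nonrepetitive on the
unit squares and whose boundary carries a square-free word over `{0, 1, 2}`, interrupted by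
the color `3` at `(0, 0)`. -/
structure IsGoodColoring (N : ℕ) (b : ℕ → ℕ) (c : ℕ → ℕ → ℕ) : Prop where
  lt_four : ∀ i j, c i j < 4
  square : IsSquareColoring N c
  boundary : ∀ i ≤ N, ∀ j ≤ N, i = 0 ∨ i = N ∨ j = 0 ∨ j = N → c i j = boundaryColor N b i j
  word_lt : ∀ k, b k < 3
  squareFree : ∀ i p, 1 ≤ i → 0 < p → i + 2 * p ≤ 4 * N → ∃ k < p, b (i + k) ≠ b (i + k + p)

lemma exists_isGoodColoring_three : ∃ b c, IsGoodColoring 3 b c := by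
  refine ⟨fun k ↦ [0, 0, 1, 0, 2, 0, 1, 2, 0, 2, 1, 2].getD k 0,
    fun i j ↦ ([[3, 0, 1, 0], [2, 3, 0, 2], [1, 2, 3, 0], [2, 0, 2, 1]].getD i []).getD j 0,
    fun i j ↦ ?_, ⟨by decide, by decide, by decide⟩, by decide, fun k ↦ ?_, ?_⟩
  · rcases i with _ | _ | _ | _ | i <;> rcases j with _ | _ | _ | _ | j <;> simp
  · rcases Nat.lt_or_ge k 12 with h | h
    · interval_cases k <;> decide
    · simp [h]
  · have key : ∀ i ∈ Finset.range 12, ∀ p ∈ Finset.range 6, 1 ≤ i → 0 < p → i + 2 * p ≤ 12 →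
      ∃ k ∈ Finset.range p,
        [0, 0, 1, 0, 2, 0, 1, 2, 0, 2, 1, 2].getD (i + k) 0 ≠
          [0, 0, 1, 0, 2, 0, 1, 2, 0, 2, 1, 2].getD (i + k + p) 0 := by
      decide
    intro i p h₁ h₂ h₃
    simpa using key i (Finset.mem_range.2 (by omega)) p (Finset.mem_range.2 (by omega)) h₁ h₂ h₃

lemma exists_isGoodColoring {N : ℕ} (hN : 1 ≤ N) : ∃ b c, IsGoodColoring N b c := by
  by_cases hN3 : N = 3
  · subst hN3
    exact exists_isGoodColoring_three
  obtain ⟨s, -, hs⟩ := thueWord_squareFree (4 * N - 2) (by omega) 1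
  have hword : ∀ k, thueWord (s + k) < 3 := fun k ↦ thueWord_lt_three _
  have hstep : ∀ k, thueWord (s + k) ≠ thueWord (s + (k + 1)) := by
    intro k
    obtain ⟨m, hm, h⟩ := thueWord_squareFree 1 one_pos (s + k)
    obtain rfl : m = 0 := by omega
    exact h
  obtain ⟨c, hc4, hc, hcb⟩ := exists_squareColoring hN hN3 hword hstep (by
    rwa [show 1 + s + (4 * N - 2) = s + (4 * N - 1) by omega, add_comm 1 s] at hs)
  refine ⟨_, c, hc4, hc, hcb, hword, fun i p _ hp _ ↦ ?_⟩
  simpa only [add_assoc] using thueWord_squareFree p hp (s + i)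

lemma nonrepetitiveList_map {V α : Type*} {c : V → α} {p : List V}
    (h : ∀ q : List V, q <:+: p → ∀ l : ℕ, 0 < l → ∀ hq : q.length = 2 * l,
      ¬ ∀ (k : ℕ) (hk : k < l), c q[k] = c q[k + l]) :
    NonrepetitiveList (p.map c) := by
  intro u hu hinf
  obtain ⟨q, hq, hqu⟩ := List.infix_map_iff.1 hinf
  have hlen : q.length = 2 * u.length := by
    have := congrArg List.length hqu
    simp only [List.length_append, List.length_map] at this
    omega
  refine h q hq u.length (List.length_pos_iff.2 hu) hlen fun k hk ↦ ?_
  have h₁ : (q.map c)[k]'(by simp; omega) = u[k] := by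
    simp only [← hqu, List.getElem_append_left hk]
  have h₂ : (q.map c)[k + u.length]'(by simp; omega) = u[k] := by
    simp only [← hqu]
    rw [List.getElem_append_right (by omega)]
    simp
  rw [List.getElem_map] at h₁ h₂
  rw [h₁, h₂]

/-- The closed walk `w`, run through twice, is a walk. -/
lemma isChain_append_self {V : Type*} {R : V → V → Prop} {w : List V}
    (h : ∀ p ∈ cyclicPairs w, R p.1 p.2) : List.IsChain R (w ++ w) := by
  have step : ∀ k (hk : k < w.length),
      R w[k] (w[(k + 1) % w.length]'(Nat.mod_lt _ (by omega))) := by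
    intro k hk
    refine h (w[k], _) (List.mem_iff_getElem.2 ⟨k, by simpa [cyclicPairs] using hk, ?_⟩)
    simp [cyclicPairs, List.getElem_zip, List.getElem_rotate]
  rw [List.isChain_iff_getElem]
  intro k hk
  rw [List.length_append] at hk
  rcases Nat.lt_trichotomy (k + 1) w.length with h₁ | h₁ | h₁
  · have := step k (by omega)
    simp only [Nat.mod_eq_of_lt h₁] at this
    rwa [List.getElem_append_left (by omega), List.getElem_append_left h₁]
  · have := step k (by omega)
    simp only [h₁, Nat.mod_self] at this
    rw [List.getElem_append_left (by omega), List.getElem_append_right (by omega)]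
    simpa [h₁] using this
  · have := step (k - w.length) (by omega)
    simp only [Nat.mod_eq_of_lt (show k - w.length + 1 < w.length by omega)] at this
    rw [List.getElem_append_right (by omega), List.getElem_append_right (by omega)]
    simpa [Nat.sub_add_comm (show w.length ≤ k by omega)] using this

/-- An injective walk in the path graph on `ℕ` is monotone. -/
lemma walk_monotone {L : ℕ} {f : ℕ → ℕ}
    (hstep : ∀ k, k + 1 < L → f (k + 1) = f k + 1 ∨ f k = f (k + 1) + 1)
    (hinj : ∀ k, k + 2 < L → f k ≠ f (k + 2)) :
    (∀ k < L, f k = f 0 + k) ∨ (∀ k < L, f k + k = f 0) := by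
  rcases Nat.lt_or_ge 1 L with hL | hL
  · rcases hstep 0 hL with h₀ | h₀
    · have key : ∀ k, k + 1 < L → f k = f 0 + k ∧ f (k + 1) = f 0 + (k + 1) := by
        intro k
        induction k with
        | zero => intro _; simpa using h₀
        | succ k ih =>
          intro hk
          have := ih (by omega)
          have := hstep (k + 1) hk
          have := hinj k hk
          simp only [add_assoc, Nat.reduceAdd] at *
          omega
      refine Or.inl fun k hk ↦ ?_
      rcases k with _ | k
      · rfl
      · exact (key k hk).2
    · have key : ∀ k, k + 1 < L → f k + k = f 0 ∧ f (k + 1) + (k + 1) = f 0 := by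
        intro k
        induction k with
        | zero => intro _; simpa using h₀.symm
        | succ k ih =>
          intro hk
          have := ih (by omega)
          have := hstep (k + 1) hk
          have := hinj k hk
          simp only [add_assoc, Nat.reduceAdd] at *
          omega
      refine Or.inr fun k hk ↦ ?_
      rcases k with _ | k
      · rfl
      · exact (key k hk).2
  · refine Or.inl fun k hk ↦ ?_
    obtain rfl : k = 0 := by omega
    rfl

lemma gridGraph_adj_iff {n : ℕ} {u v : Fin n × Fin n} : (gridGraph n).Adj u v ↔
    ((u.1 : ℕ) = v.1 ∧ ((u.2 : ℕ) + 1 = v.2 ∨ (v.2 : ℕ) + 1 = u.2)) ∨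
    ((u.2 : ℕ) = v.2 ∧ ((u.1 : ℕ) + 1 = v.1 ∨ (v.1 : ℕ) + 1 = u.1)) := by
  rw [gridGraph, SimpleGraph.fromRel_adj, Ne, Prod.ext_iff]
  simp only [Fin.ext_iff]
  omega

lemma boundaryIndex_of_adj {n : ℕ} {u v : Fin n × Fin n}
    (hu : (u.1 : ℕ) = 0 ∨ (u.1 : ℕ) = n - 1 ∨ (u.2 : ℕ) = 0 ∨ (u.2 : ℕ) = n - 1)
    (hv : (v.1 : ℕ) = 0 ∨ (v.1 : ℕ) = n - 1 ∨ (v.2 : ℕ) = 0 ∨ (v.2 : ℕ) = n - 1)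
    (hu₀ : ¬ ((u.1 : ℕ) = 0 ∧ (u.2 : ℕ) = 0)) (hv₀ : ¬ ((v.1 : ℕ) = 0 ∧ (v.2 : ℕ) = 0))
    (h : (gridGraph n).Adj u v) :
    boundaryIndex (n - 1) v.1 v.2 = boundaryIndex (n - 1) u.1 u.2 + 1 ∨
      boundaryIndex (n - 1) u.1 u.2 = boundaryIndex (n - 1) v.1 v.2 + 1 := by
  rw [gridGraph_adj_iff] at h
  have h₁ := u.1.isLt
  have h₂ := u.2.isLt
  have h₃ := v.1.isLt
  have h₄ := v.2.isLt
  unfold boundaryIndex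
  split_ifs <;> first | contradiction | omega

lemma boundaryIndex_bounds {N i j : ℕ} (hi : i ≤ N) (hj : j ≤ N)
    (h : i = 0 ∨ i = N ∨ j = 0 ∨ j = N) (h₀ : ¬ (i = 0 ∧ j = 0)) :
    1 ≤ boundaryIndex N i j ∧ boundaryIndex N i j + 1 ≤ 4 * N := by
  unfold boundaryIndex
  split_ifs <;> first | contradiction | omega

lemma boundaryIndex_inj {N i j i' j' : ℕ} (hi : i ≤ N) (hj : j ≤ N) (hi' : i' ≤ N) (hj' : j' ≤ N)
    (h : i = 0 ∨ i = N ∨ j = 0 ∨ j = N) (h' : i' = 0 ∨ i' = N ∨ j' = 0 ∨ j' = N)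
    (h₀ : ¬ (i = 0 ∧ j = 0)) (h₀' : ¬ (i' = 0 ∧ j' = 0))
    (he : boundaryIndex N i j = boundaryIndex N i' j') : i = i' ∧ j = j' := by
  unfold boundaryIndex at he
  split_ifs at he <;> first | contradiction | omega

/-- A path in the boundary of the grid does not carry a repetition. -/
lemma IsGoodColoring.boundary_path {n : ℕ} {b : ℕ → ℕ} {c : ℕ → ℕ → ℕ}
    (h : IsGoodColoring (n - 1) b c) {q : List (Fin n × Fin n)} {l : ℕ} (hl : 0 < l)
    (hq : q.length = 2 * l) (hnd : q.Nodup) (hch : q.IsChain (gridGraph n).Adj)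
    (hbd : ∀ v ∈ q, (v.1 : ℕ) = 0 ∨ (v.1 : ℕ) = n - 1 ∨ (v.2 : ℕ) = 0 ∨ (v.2 : ℕ) = n - 1) :
    ¬ ∀ (k : ℕ) (hk : k < l), c q[k].1 q[k].2 = c q[k + l].1 q[k + l].2 := by
  intro hrep
  have hb : ∀ (k : ℕ) (hk : k < q.length), (q[k].1 : ℕ) = 0 ∨ (q[k].1 : ℕ) = n - 1 ∨
      (q[k].2 : ℕ) = 0 ∨ (q[k].2 : ℕ) = n - 1 := fun k hk ↦ hbd _ (List.getElem_mem hk)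
  have hle : ∀ i : Fin n, (i : ℕ) ≤ n - 1 := fun i ↦ by omega
  have hcol : ∀ (k : ℕ) (hk : k < q.length), c q[k].1 q[k].2 =
      boundaryColor (n - 1) b q[k].1 q[k].2 := fun k hk ↦
    h.boundary _ (hle _) _ (hle _) (hb k hk)
  have hinj : ∀ (k m : ℕ) (hk : k < q.length) (hm : m < q.length), (q[k].1 : ℕ) = q[m].1 →
      (q[k].2 : ℕ) = q[m].2 → k = m := fun k m hk hm h₁ h₂ ↦
    (hnd.getElem_inj_iff).1 (Prod.ext (Fin.ext h₁) (Fin.ext h₂))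
  have h3 : ∀ u v : Fin n × Fin n, ((u.1 : ℕ) = 0 ∧ (u.2 : ℕ) = 0) →
      boundaryColor (n - 1) b u.1 u.2 = boundaryColor (n - 1) b v.1 v.2 →
      ((v.1 : ℕ) = 0 ∧ (v.2 : ℕ) = 0) := by
    intro u v hu huv
    by_contra hv
    rw [boundaryColor, boundaryColor, if_pos hu, if_neg hv] at huv
    have := h.word_lt (boundaryIndex (n - 1) v.1 v.2)
    omega
  have h₀ : ∀ (k : ℕ) (hk : k < q.length), ¬ ((q[k].1 : ℕ) = 0 ∧ (q[k].2 : ℕ) = 0) := by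
    intro k hk hk₀
    rcases Nat.lt_or_ge k l with hkl | hkl
    · have hr := hrep k hkl
      rw [hcol k hk, hcol (k + l) (by omega)] at hr
      have := h3 _ _ hk₀ hr
      have := hinj k (k + l) hk (by omega) (by omega) (by omega)
      omega
    · obtain ⟨m, rfl⟩ := Nat.exists_eq_add_of_le' hkl
      have hr := hrep m (by omega)
      rw [hcol m (by omega), hcol (m + l) hk] at hr
      have := h3 _ _ hk₀ hr.symm
      have := hinj m (m + l) (by omega) hk (by omega) (by omega)
      omega
  set f : ℕ → ℕ := fun k ↦
    if hk : k < q.length then boundaryIndex (n - 1) q[k].1 q[k].2 else 0 with hf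
  have hfk : ∀ (k : ℕ) (hk : k < q.length), f k = boundaryIndex (n - 1) q[k].1 q[k].2 :=
    fun k hk ↦ dif_pos hk
  have hfb : ∀ k < q.length, 1 ≤ f k ∧ f k + 1 ≤ 4 * (n - 1) := by
    intro k hk
    rw [hfk k hk]
    exact boundaryIndex_bounds (hle _) (hle _) (hb k hk) (h₀ k hk)
  have hword : ∀ k < l, b (f k) = b (f (k + l)) := by
    intro k hk
    have hr := hrep k hk
    rw [hcol k (by omega), hcol (k + l) (by omega), boundaryColor, boundaryColor,
      if_neg (h₀ _ _), if_neg (h₀ _ _)] at hr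
    rwa [hfk k (by omega), hfk (k + l) (by omega)]
  have hmono := walk_monotone (L := q.length) (f := f)
    (fun k hk ↦ by
      rw [hfk k (by omega), hfk (k + 1) hk]
      exact boundaryIndex_of_adj (hb _ _) (hb _ _) (h₀ _ _) (h₀ _ _)
        (List.isChain_iff_getElem.1 hch k hk))
    (fun k hk he ↦ by
      rw [hfk k (by omega), hfk (k + 2) hk] at he
      obtain ⟨h₁, h₂⟩ := boundaryIndex_inj (hle _) (hle _) (hle _) (hle _) (hb _ _) (hb _ _)
        (h₀ _ _) (h₀ _ _) he
      have := hinj k (k + 2) (by omega) hk h₁ h₂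
      omega)
  have hfirst := hfb 0 (by omega)
  have hlast := hfb (2 * l - 1) (by omega)
  rcases hmono with hmono | hmono
  · have := hmono (2 * l - 1) (by omega)
    obtain ⟨k, hk, hne⟩ := h.squareFree (f 0) l hfirst.1 hl (by omega)
    refine hne ?_
    rw [← hmono k (by omega), hword k hk, hmono (k + l) (by omega), hmono k (by omega), add_assoc]
  · have hm := hmono (2 * l - 1) (by omega)
    obtain ⟨k, hk, hne⟩ := h.squareFree (f (2 * l - 1)) l hlast.1 hl (by omega)
    refine hne ?_
    have h₁ := hmono (2 * l - 1 - k) (by omega)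
    have h₂ := hmono (l - 1 - k) (by omega)
    have h₃ := hword (l - 1 - k) (by omega)
    rw [show l - 1 - k + l = 2 * l - 1 - k by omega] at h₃
    rw [show f (2 * l - 1) + k = f (2 * l - 1 - k) by omega, ← h₃]
    congr 1
    omega

/-- A path in a unit square of the grid does not carry a repetition. -/
lemma IsSquareColoring.square_path {n : ℕ} {c : ℕ → ℕ → ℕ} (h : IsSquareColoring (n - 1) c)
    {q : List (Fin n × Fin n)} {l i j : ℕ} (hl : 0 < l) (hl2 : l ≤ 2) (hq : q.length = 2 * l)
    (hnd : q.Nodup) (hch : q.IsChain (gridGraph n).Adj) (hi : i + 1 < n) (hj : j + 1 < n)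
    (hsq : ∀ v ∈ q, ((v.1 : ℕ) = i ∨ (v.1 : ℕ) = i + 1) ∧ ((v.2 : ℕ) = j ∨ (v.2 : ℕ) = j + 1)) :
    ¬ ∀ (k : ℕ) (hk : k < l), c q[k].1 q[k].2 = c q[k + l].1 q[k + l].2 := by
  intro hrep
  have hv₁ := h.vert i (by omega) j (by omega)
  have hv₂ := h.vert i (by omega) (j + 1) (by omega)
  have hh₁ := h.horiz i (by omega) j (by omega)
  have hh₂ := h.horiz (i + 1) (by omega) j (by omega)
  have hd := h.diag i (by omega) j (by omega)
  have hadj : ∀ (k : ℕ) (hk : k + 1 < q.length), _ := fun k hk ↦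
    gridGraph_adj_iff.1 (List.isChain_iff_getElem.1 hch k hk)
  have hsq' : ∀ (k : ℕ) (hk : k < q.length), _ := fun k hk ↦ hsq _ (List.getElem_mem hk)
  have hinj : ∀ (k m : ℕ) (hk : k < q.length) (hm : m < q.length), k ≠ m →
      ¬ ((q[k].1 : ℕ) = q[m].1 ∧ (q[k].2 : ℕ) = q[m].2) := fun k m hk hm hkm h' ↦
    hkm ((hnd.getElem_inj_iff).1 (Prod.ext (Fin.ext h'.1) (Fin.ext h'.2)))
  obtain rfl | rfl : l = 1 ∨ l = 2 := by omega
  · have hr := hrep 0 (by omega)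
    have ha := hadj 0 (by omega)
    obtain ⟨h₁ | h₁, h₂ | h₂⟩ := hsq' 0 (by omega) <;>
    obtain ⟨h₃ | h₃, h₄ | h₄⟩ := hsq' 1 (by omega) <;>
    simp only [zero_add, h₁, h₂, h₃, h₄] at hr ha <;> omega
  · have hr₀ := hrep 0 (by omega)
    have hr₁ := hrep 1 (by omega)
    have ha₀ := hadj 0 (by omega)
    have ha₁ := hadj 1 (by omega)
    have ha₂ := hadj 2 (by omega)
    have hn₀ := hinj 0 2 (by omega) (by omega) (by omega)
    have hn₁ := hinj 1 3 (by omega) (by omega) (by omega)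
    have hs₂ := hsq' 2 (by omega)
    have hs₃ := hsq' 3 (by omega)
    simp only [zero_add, Nat.reduceAdd] at hr₀ hr₁ ha₀ ha₁ ha₂
    obtain ⟨h₁ | h₁, h₂ | h₂⟩ := hsq' 0 (by omega) <;>
    obtain ⟨h₃ | h₃, h₄ | h₄⟩ := hsq' 1 (by omega) <;>
    first
    | omega
    | (obtain ⟨h₅ | h₅, h₆ | h₆⟩ := hs₂ <;> first
      | omega
      | (obtain ⟨h₇ | h₇, h₈ | h₈⟩ := hs₃ <;> first
        | omega
        | (simp only [h₁, h₂, h₃, h₄, h₅, h₆, h₇, h₈] at hr₀ hr₁; omega)))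

/-- For the `n × n` grid graph with its standard plane embedding (the inner faces are
the unit 4-cycles and the outer face is bounded by the boundary cycle), the facial
Thue chromatic number satisfies `π_f(G_{n×n}) ≤ 4`. -/
theorem facialThue_grid_le_four {n : ℕ} (P : PlaneGraph (Fin n × Fin n))
    (hgraph : P.graph = gridGraph n)
    -- every inner face is a unit 4-cycle
    (hinner : ∀ F ∈ P.faces, F ≠ P.outer →
      ∃ (w : List (Fin n × Fin n)) (i i' j j' : Fin n),
        F = {w} ∧ w.Nodup ∧ w.length = 4 ∧
        (i' : ℕ) = (i : ℕ) + 1 ∧ (j' : ℕ) = (j : ℕ) + 1 ∧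
        {v | v ∈ w} = ({(i, j), (i', j), (i', j'), (i, j')} : Set (Fin n × Fin n)))
    -- the outer face is bounded by the boundary cycle
    (houter : ∃ w₀ : List (Fin n × Fin n),
      P.outer = {w₀} ∧ w₀.Nodup ∧
      {v | v ∈ w₀} =
        {p : Fin n × Fin n |
          (p.1 : ℕ) = 0 ∨ (p.1 : ℕ) = n - 1 ∨ (p.2 : ℕ) = 0 ∨ (p.2 : ℕ) = n - 1}) :
    P.facialThue ≤ 4 := by
  rcases Nat.lt_or_ge n 2 with hn | hn
  · refine Nat.sInf_le ⟨fun _ ↦ 0, fun p hp ↦ nonrepetitiveList_map fun q hq l hl hql ↦ ?_⟩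
    have h₁ := (hq.nodup hp.2.1).length_le_card
    have h₂ : Fintype.card (Fin n × Fin n) ≤ 1 := by
      interval_cases n <;> simp
    omega
  obtain ⟨b, c, hc⟩ := exists_isGoodColoring (N := n - 1) (by omega)
  refine Nat.sInf_le ⟨fun v ↦ ⟨c v.1 v.2, hc.lt_four _ _⟩,
    fun p hp ↦ nonrepetitiveList_map fun q hq l hl hql ↦ ?_⟩
  obtain ⟨-, hpnd, F, hF, w, hw, hpw⟩ := hp
  have hqw := hq.trans hpw
  have hqnd := hq.nodup hpnd
  have hqmem : ∀ v ∈ q, v ∈ w := fun v hv ↦ by simpa using hqw.subset hv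
  have hchain : 2 ≤ w.length → q.IsChain (gridGraph n).Adj := fun h2 ↦
    (isChain_append_self (hgraph ▸ P.walk_adj F hF w hw h2)).infix hqw
  simp only [Fin.mk.injEq]
  by_cases hFo : F = P.outer
  · obtain ⟨w₀, hw₀, -, hset⟩ := houter
    obtain rfl : w = w₀ := by simpa [hFo, hw₀] using hw
    have hmem : ∀ v, v ∈ w ↔ _ := Set.ext_iff.1 hset
    have h2 : 2 ≤ w.length := by
      have hsub := hqnd.subperm fun v hv ↦ hqmem v hv
      have := hsub.length_le
      omega
    exact hc.boundary_path hl hql hqnd (hchain h2) fun v hv ↦ (hmem v).1 (hqmem v hv)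
  · obtain ⟨w', i, i', j, j', hFw, -, hlen, hi, hj, hset⟩ := hinner F hF hFo
    obtain rfl : w = w' := by simpa [hFw] using hw
    have hmem : ∀ v, v ∈ w ↔ _ := Set.ext_iff.1 hset
    have := (hqnd.subperm fun v hv ↦ hqmem v hv).length_le
    refine hc.square.square_path (i := i) (j := j) hl (by omega) hql hqnd (hchain (by omega))
      (by omega) (by omega) fun v hv ↦ ?_
    have hv' := (hmem v).1 (hqmem v hv)
    simp only [Set.mem_insert_iff, Set.mem_singleton_iff] at hv'
    rcases hv' with rfl | rfl | rfl | rfl <;> simp [hi, hj]
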